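/- (Urysohn's lemma for MT-algebras) Let (M, □) be a normal MT-algebra, let a be an open element and c a closed element of M with c ≤ a. Then there exists a family (u_p) of open elements of M indexed by p ∈ ℚ ∩ [0,1] such that c ≤ u_0, u_1 ≤ a, and u_p ◁ u_q (i.e. ◇u_p ≤ □u_q) whenever p < q. -/

import Mathlib

universe u

/-- An MT-algebra: a complete Boolean algebra equipped with an interior operator. -/
structure MTAlg (M : Type u) [CompleteBooleanAlgebra M] where
  box : M → M
  box_top : box ⊤ = ⊤
  box_inf : ∀ a b : M, box (a ⊓ b) = box a ⊓ box b
  box_le : ∀ a : M, box a ≤ a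
  box_idem : ∀ a : M, box a ≤ box (box a)

namespace MTAlg

variable {M : Type u} [CompleteBooleanAlgebra M] (T : MTAlg M)

/-- The closure operator `◇a = (□(aᶜ))ᶜ`. -/
def dia (a : M) : M := (T.box aᶜ)ᶜ

/-- An element is open if `□a = a`. -/
def IsOp (a : M) : Prop := T.box a = a

/-- An element is closed if `◇a = a`. -/
def IsCl (a : M) : Prop := T.dia a = a

/-- The set `O(M)` of open elements. -/
def opens : Set M := {a | T.IsOp a}

/-- The set `C(M)` of closed elements. -/
def closeds : Set M := {a | T.IsCl a}

/-- A subset join-generates `M` if every element of `M` is a supremum of a subset of it. -/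
def JoinGenerates (S : Set M) : Prop := ∀ a : M, ∃ B ⊆ S, a = sSup B

theorem box_mono {a b : M} (h : a ≤ b) : T.box a ≤ T.box b := by
  have hab : a ⊓ b = a := inf_eq_left.mpr h
  calc T.box a = T.box (a ⊓ b) := by rw [hab]
    _ = T.box a ⊓ T.box b := T.box_inf a b
    _ ≤ T.box b := inf_le_right

theorem isOp_sSup {S : Set M} (h : ∀ a ∈ S, T.IsOp a) : T.IsOp (sSup S) := by
  refine le_antisymm (T.box_le _) (sSup_le fun a ha => ?_)
  calc a = T.box a := (h a ha).symm
    _ ≤ T.box (sSup S) := T.box_mono (le_sSup ha)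

theorem atom_le_sSup {x : M} (hx : IsAtom x) {S : Set M} (h : x ≤ sSup S) :
    ∃ s ∈ S, x ≤ s := by
  by_contra hc
  push_neg at hc
  have h2 : ∀ b ∈ S, x ⊓ b = ⊥ := by
    intro b hb
    rcases hx.le_iff.mp (inf_le_left : x ⊓ b ≤ x) with h' | h'
    · exact h'
    · exact absurd (h' ▸ inf_le_right) (hc b hb)
  have h3 : x ⊓ sSup S = ⊥ := by
    rw [inf_sSup_eq]
    simp only [iSup_eq_bot]
    intro b hb
    exact h2 b hb
  have hx' : x = ⊥ := by
    rw [inf_eq_left.mpr h] at h3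
    exact h3
  exact hx.1 hx'

/-- `η(a)` : the set of atoms below `a`. -/
def eta (a : M) : Set {x : M // IsAtom x} := {x | (x : M) ≤ a}

/-- The topology `τ = {η(a) | a ∈ O(M)}` on the set of atoms of `M`. -/
def atomTopology : TopologicalSpace {x : M // IsAtom x} where
  IsOpen U := ∃ a : M, T.IsOp a ∧ U = eta a
  isOpen_univ := ⟨⊤, T.box_top, by ext x; simp [eta]⟩
  isOpen_inter := by
    rintro U V ⟨a, ha, rfl⟩ ⟨b, hb, rfl⟩
    refine ⟨a ⊓ b, ?_, ?_⟩
    · show T.box (a ⊓ b) = a ⊓ b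
      rw [T.box_inf, ha, hb]
    · ext x
      simp [eta, le_inf_iff]
  isOpen_sUnion := by
    intro C hC
    refine ⟨sSup {a | T.IsOp a ∧ eta a ∈ C}, T.isOp_sSup (fun a ha => ha.1), ?_⟩
    ext x
    constructor
    · rintro ⟨U, hU, hxU⟩
      obtain ⟨a, ha, rfl⟩ := hC U hU
      exact le_trans hxU (le_sSup ⟨ha, hU⟩)
    · intro hx
      obtain ⟨s, hs, hxs⟩ := atom_le_sSup x.2 hx
      exact ⟨eta s, hs.2, hxs⟩

/-- A completely prime filter of the frame `O(M)` (with arbitrary suprema computed in `M`). -/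
structure IsCPF (p : Set M) : Prop where
  subset_opens : p ⊆ T.opens
  top_mem : ⊤ ∈ p
  bot_notMem : ⊥ ∉ p
  mem_of_le : ∀ a ∈ p, ∀ b ∈ T.opens, a ≤ b → b ∈ p
  inf_mem : ∀ a ∈ p, ∀ b ∈ p, a ⊓ b ∈ p
  prime : ∀ S ⊆ T.opens, sSup S ∈ p → ∃ s ∈ S, s ∈ p

/-- The underlying set of `θ(x) = {a ∈ O(M) | x ≤ a}`. -/
def thetaSet (x : M) : Set M := {a | T.IsOp a ∧ x ≤ a}

/-- An element is saturated if it is an infimum of a set of open elements. -/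
def IsSat (a : M) : Prop := ∃ S ⊆ T.opens, a = sInf S

/-- Weakly locally closed: the infimum of a saturated element and a closed element. -/
def IsWLC (a : M) : Prop := ∃ s c : M, T.IsSat s ∧ T.IsCl c ∧ a = s ⊓ c

/-- Locally closed: the infimum of an open element and a closed element. -/
def IsLC (a : M) : Prop := ∃ u c : M, T.IsOp u ∧ T.IsCl c ∧ a = u ⊓ c

/-- `M` is a `T₀`-algebra if the weakly locally closed elements join-generate `M`. -/
def T0 : Prop := JoinGenerates {a | T.IsWLC a}

/-- `M` is a `T_{1/2}`-algebra if the locally closed elements join-generate `M`. -/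
def THalf : Prop := JoinGenerates {a | T.IsLC a}

/-- `M` is a `T₁`-algebra if the closed elements join-generate `M`. -/
def T1 : Prop := JoinGenerates T.closeds

/-- A join-irreducible element of `C(M)`. -/
def JoinIrred (p : M) : Prop :=
  T.IsCl p ∧ p ≠ ⊥ ∧ ∀ a b : M, T.IsCl a → T.IsCl b → p = a ⊔ b → p = a ∨ p = b

/-- `M` is weakly sober if every join-irreducible element of `C(M)` is `◇x` for some atom `x`. -/
def WeaklySober : Prop := ∀ p : M, T.JoinIrred p → ∃ x : M, IsAtom x ∧ p = T.dia x

/-- `M` is sober if it is weakly sober and a `T₀`-algebra. -/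
def Sober : Prop := T.WeaklySober ∧ T.T0

/-- `a ∈ GC(M)` : `a` is approximated from above by regular closed elements. -/
def IsGC (a : M) : Prop := a = sInf {b | ∃ c : M, a ≤ T.box c ∧ b = T.dia (T.box c)}

/-- `M` is a Hausdorff (T₂) algebra if `GC(M)` join-generates `M`. -/
def Hausdorff : Prop := JoinGenerates {a | T.IsGC a}

/-- `a ◁ b` iff `◇a ≤ □b`. -/
def tri (a b : M) : Prop := T.dia a ≤ T.box b

/-- `M` is a regular (T₃) algebra. -/
def Regular : Prop :=
  T.T1 ∧ ∀ a : M, T.IsOp a → a = sSup {b | T.IsOp b ∧ T.tri b a}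

/-- `a ◁◁ b` : there is a family `(c_p)` indexed by `p ∈ ℚ ∩ [0,1]` interpolating
between `a` and `b` with `c_p ◁ c_q` whenever `p < q`. -/
def triQ (a b : M) : Prop :=
  ∃ c : ℚ → M, a ≤ c 0 ∧ c 1 ≤ b ∧
    ∀ p q : ℚ, 0 ≤ p → p < q → q ≤ 1 → T.tri (c p) (c q)

/-- `M` is a completely regular (T₃½) algebra. -/
def CompletelyRegular : Prop :=
  T.T1 ∧ ∀ a : M, T.IsOp a → a = sSup {b | T.IsOp b ∧ T.triQ b a}

/-- The pseudocomplement of `b` in the frame `O(M)`. -/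
def pstarO (b : M) : M := sSup {u | T.IsOp u ∧ u ⊓ b = ⊥}

/-- The rather-below relation `b ≺ a` in the frame `O(M)`. -/
def precO (b a : M) : Prop := T.pstarO b ⊔ a = ⊤

/-- The completely-below relation `b ≺≺ a` in the frame `O(M)`. -/
def precQO (b a : M) : Prop :=
  ∃ c : ℚ → M, (∀ p : ℚ, 0 ≤ p → p ≤ 1 → T.IsOp (c p)) ∧ b ≤ c 0 ∧ c 1 ≤ a ∧
    ∀ p q : ℚ, 0 ≤ p → p < q → q ≤ 1 → T.precO (c p) (c q)

/-- The frame `O(M)` is completely regular. -/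
def FrameCompletelyRegular : Prop :=
  ∀ a : M, T.IsOp a → a = sSup {b | T.IsOp b ∧ T.precQO b a}

/-- `M` is a normal (T₄) algebra. -/
def Normal : Prop :=
  T.T1 ∧ ∀ c d : M, T.IsCl c → T.IsCl d → c ⊓ d = ⊥ →
    ∃ a b : M, T.IsOp a ∧ T.IsOp b ∧ a ⊓ b = ⊥ ∧ c ≤ a ∧ d ≤ b

end MTAlg


theorem MTAlg.dia_mono' {M : Type u} [CompleteBooleanAlgebra M] (T : MTAlg M)
    {x y : M} (h : x ≤ y) : T.dia x ≤ T.dia y :=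
  compl_le_compl (T.box_mono (compl_le_compl h))

theorem MTAlg.le_dia' {M : Type u} [CompleteBooleanAlgebra M] (T : MTAlg M)
    (x : M) : x ≤ T.dia x :=
  le_compl_comm.mp (T.box_le _)

theorem MTAlg.isCl_dia' {M : Type u} [CompleteBooleanAlgebra M] (T : MTAlg M)
    (x : M) : T.IsCl (T.dia x) := by
  unfold MTAlg.IsCl MTAlg.dia
  rw [compl_compl, le_antisymm (T.box_le _) (T.box_idem xᶜ)]

theorem MTAlg.interp' {M : Type u} [CompleteBooleanAlgebra M] (T : MTAlg M)
    (hN : T.Normal) {a c : M} (ha : T.IsOp a) (hc : T.IsCl c) (hca : c ≤ a) :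
    ∃ w, T.IsOp w ∧ c ≤ w ∧ T.dia w ≤ a := by
  have hcl : T.IsCl aᶜ := by
    unfold MTAlg.IsCl MTAlg.dia
    rw [compl_compl, ha]
  obtain ⟨x, y, hx, hy, hxy, hcx, hay⟩ := hN.2 c aᶜ hc hcl
    (disjoint_iff.mp (disjoint_compl_right_iff.mpr hca))
  refine ⟨x, hx, hcx, ?_⟩
  have h1 : y ≤ xᶜ := (disjoint_iff.mpr hxy).symm.le_compl_right
  have h2 : y ≤ T.box xᶜ := by
    rw [← hy]
    exact T.box_mono h1
  exact compl_le_iff_compl_le.mp (hay.trans h2)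

/-- Dyadic refinement. -/
def urysF {M : Type u} (I : M → M → M) (f0 : ℕ → M) : ℕ → ℕ → M
  | 0, k => f0 k
  | n + 1, k => if k % 2 = 0 then urysF I f0 n (k / 2)
      else I (urysF I f0 n (k / 2)) (urysF I f0 n (k / 2 + 1))

theorem urysF_mul {M : Type u} (I : M → M → M) (f0 : ℕ → M) (m n k : ℕ) :
    urysF I f0 (m + n) (k * 2 ^ n) = urysF I f0 m k := by
  induction n with
  | zero => simp
  | succ n ih =>
    rw [← ih, ← Nat.add_assoc, urysF]
    have : k * 2 ^ (n + 1) = 2 * (k * 2 ^ n) := by ring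
    rw [this]
    simp

/-- Urysohn's lemma for MT-algebras: in a normal MT-algebra, if `a` is
open, `c` is closed and `c ≤ a`, then there is a family of open elements `(u_p)`
indexed by `p ∈ ℚ ∩ [0,1]` with `c ≤ u₀`, `u₁ ≤ a`, and `◇u_p ≤ □u_q` whenever
`p < q`. -/
theorem statement18 {M : Type u} [CompleteBooleanAlgebra M] (T : MTAlg M)
    (hN : T.Normal) (a c : M) (ha : T.IsOp a) (hc : T.IsCl c) (hca : c ≤ a) :
    ∃ u : ℚ → M, (∀ p : ℚ, 0 ≤ p → p ≤ 1 → T.IsOp (u p)) ∧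
      c ≤ u 0 ∧ u 1 ≤ a ∧
      ∀ p q : ℚ, 0 ≤ p → p < q → q ≤ 1 → T.dia (u p) ≤ T.box (u q) := by
  have hI : ∀ x y : M, ∃ w, T.IsOp y → T.dia x ≤ y →
      T.IsOp w ∧ T.dia x ≤ w ∧ T.dia w ≤ y := by
    intro x y
    by_cases h : T.IsOp y ∧ T.dia x ≤ y
    · obtain ⟨w, hw⟩ := T.interp' hN h.1 (T.isCl_dia' x) h.2
      exact ⟨w, fun _ _ => hw⟩
    · exact ⟨⊥, fun h1 h2 => absurd ⟨h1, h2⟩ h⟩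
  choose I hI using hI
  obtain ⟨w, hw, hcw, hwa⟩ := T.interp' hN ha hc hca
  let f0 : ℕ → M := fun k => if k = 0 then w else if k = 1 then a else ⊤
  let f := urysF I f0
  have key : ∀ n k, T.IsOp (f n k) ∧ T.dia (f n k) ≤ f n (k + 1) := by
    intro n
    induction n with
    | zero =>
      intro k
      rcases k with _ | _ | k
      · exact ⟨by simpa [f, f0, urysF] using hw, by simpa [f, f0, urysF] using hwa⟩
      · exact ⟨by simpa [f, f0, urysF] using ha, by simp [f, f0, urysF]⟩
      · exact ⟨by simpa [f, f0, urysF, MTAlg.IsOp] using T.box_top, by simp [f, f0, urysF]⟩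
    | succ n ih =>
      intro k
      have hk := hI (f n (k / 2)) (f n (k / 2 + 1)) (ih (k / 2 + 1)).1 (ih (k / 2)).2
      rcases Nat.mod_two_eq_zero_or_one k with h | h
      · have h1 : (k + 1) % 2 = 1 := by omega
        have h2 : (k + 1) / 2 = k / 2 := by omega
        have e1 : f (n + 1) k = f n (k / 2) := by simp [f, urysF, h]
        have e2 : f (n + 1) (k + 1) = I (f n (k / 2)) (f n (k / 2 + 1)) := by
          simp [f, urysF, h1, h2]
        rw [e1, e2]
        exact ⟨(ih _).1, hk.2.1⟩
      · have h1 : (k + 1) % 2 = 0 := by omega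
        have h2 : (k + 1) / 2 = k / 2 + 1 := by omega
        have e1 : f (n + 1) k = I (f n (k / 2)) (f n (k / 2 + 1)) := by simp [f, urysF, h]
        have e2 : f (n + 1) (k + 1) = f n (k / 2 + 1) := by
          simp [f, urysF, h1, h2]
        rw [e1, e2]
        exact ⟨hk.1, hk.2.2⟩
  have mono : ∀ n, Monotone (f n) := fun n =>
    monotone_nat_of_le_succ fun k => (T.le_dia' _).trans (key n k).2
  have cmp : ∀ m j n k, j * 2 ^ n ≤ k * 2 ^ m → f m j ≤ f n k := by
    intro m j n k h
    have e1 : f (m + n) (j * 2 ^ n) = f m j := urysF_mul I f0 m n j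
    have e2 : f (n + m) (k * 2 ^ m) = f n k := urysF_mul I f0 n m k
    rw [← e1, ← e2, Nat.add_comm n m]
    exact mono _ h
  let u : ℚ → M := fun p => sSup {x | ∃ n k : ℕ, (k : ℚ) ≤ p * 2 ^ n ∧ x = f n k}
  have uop : ∀ p, T.IsOp (u p) := by
    intro p
    apply T.isOp_sSup
    rintro x ⟨n, k, -, rfl⟩
    exact (key n k).1
  have ule : ∀ (p : ℚ) (n k : ℕ), p * 2 ^ n ≤ k → u p ≤ f n k := by
    intro p n k h
    apply sSup_le
    rintro x ⟨m, j, hj, rfl⟩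
    apply cmp
    have : (j : ℚ) * 2 ^ n ≤ k * 2 ^ m := by
      calc (j : ℚ) * 2 ^ n ≤ (p * 2 ^ m) * 2 ^ n := by gcongr
        _ = (p * 2 ^ n) * 2 ^ m := by ring
        _ ≤ k * 2 ^ m := by gcongr
    exact_mod_cast this
  refine ⟨u, fun p _ _ => uop p, ?_, ?_, ?_⟩
  · refine hcw.trans (le_sSup ⟨0, 0, by simp, by simp [f, f0, urysF]⟩)
  · have := ule 1 0 1 (by simp)
    simpa [f, f0, urysF] using this
  · intro p q hp hpq _
    rw [uop q]
    obtain ⟨n, hn⟩ := pow_unbounded_of_one_lt (2 / (q - p)) (one_lt_two : (1 : ℚ) < 2)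
    have hn' : 2 < 2 ^ n * (q - p) := (div_lt_iff₀ (sub_pos.mpr hpq)).mp hn
    have hk := Nat.le_ceil (p * 2 ^ n)
    have hk2 := Nat.ceil_lt_add_one (a := p * 2 ^ n) (by positivity)
    refine (T.dia_mono' (ule p n _ hk)).trans ((key n _).2.trans (le_sSup ⟨n, _, ?_, rfl⟩))
    push_cast
    linarith
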